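/- Let f_0, f_1, …, f_k be smooth vector fields on ℝⁿ with f_0(0) = 0, let {L_i} be the associated filtration with d_i := dim L_i(0), and define weights w = (w_1,…,w_n) by w_j = i whenever d_{i−1} < j ≤ d_i. Assume the coordinates are adapted at 0, i.e. L_i(0) = span{e_1,…,e_{d_i}} for every i, assume that for every formal bracket Λ the vector field Λ_f has graded order at most ‖Λ‖, and assume there exists m such that L_m(0) = span_ℝ{ Λ_f(0) : Λ a formal bracket }. Let f̂_0, f̂_1, …, f̂_k be the nilpotent approximation of f_0, f_1, …, f_k. Then span_ℝ{ Λ_f(0) : Λ a formal bracket } = span_ℝ{ Λ_{f̂}(0) : Λ a formal bracket }, i.e. the Lie algebras generated at 0 by the original fields and by their nilpotent approximation coincide. -/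

import Mathlib

open MeasureTheory Filter Topology Set

noncomputable section

/-- Vector fields on `ℝⁿ`. -/
abbrev VF (n : ℕ) := (Fin n → ℝ) → (Fin n → ℝ)

/-- Lie bracket of vector fields: `[V,W](x) = DW(x)[V(x)] − DV(x)[W(x)]`. -/
def lieB {n : ℕ} (V W : VF n) : VF n :=
  fun x => fderiv ℝ W x (V x) - fderiv ℝ V x (W x)

/-- Number of occurrences `|Λ|_i` of the indeterminate `X_i` in a formal
bracket `Λ` (an element of the free magma on `{X_0,…,X_k}`). -/
def occ {k : ℕ} : FreeMagma (Fin (k + 1)) → Fin (k + 1) → ℕ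
  | .of i, j => if i = j then 1 else 0
  | .mul a b, j => occ a j + occ b j

/-- Weight `‖Λ‖ = 2|Λ|₀ + Σ_{i=1}^k |Λ|_i` of a formal bracket. -/
def wt {k : ℕ} (Λ : FreeMagma (Fin (k + 1))) : ℕ :=
  2 * occ Λ 0 + ∑ i : Fin k, occ Λ i.succ

/-- Substitution of the vector fields `f_i` for the indeterminates `X_i`,
interpreting the magma operation as the Lie bracket. -/
def subst {n k : ℕ} (f : Fin (k + 1) → VF n) : FreeMagma (Fin (k + 1)) → VF n
  | .of i => f i
  | .mul a b => lieB (subst f a) (subst f b)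

/-- The evaluation at `0` of the filtration subspace
`L_i = span{Λ_f : ‖Λ‖ ≤ i}`, i.e. `L_i(0)` as a subspace of `ℝⁿ`. -/
def LxSub {n k : ℕ} (f : Fin (k + 1) → VF n) (i : ℕ) : Submodule ℝ (Fin n → ℝ) :=
  Submodule.span ℝ { v | ∃ Λ : FreeMagma (Fin (k + 1)), wt Λ ≤ i ∧ v = subst f Λ 0 }

/-- Directional derivative along the `s`-th coordinate direction. -/
def dirDeriv {n : ℕ} (s : Fin n) (g : (Fin n → ℝ) → ℝ) : (Fin n → ℝ) → ℝ :=
  fun x => fderiv ℝ g x (Pi.single s 1)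

/-- Iterated directional derivatives along a list of coordinate directions. -/
def listDeriv {n : ℕ} : List (Fin n) → ((Fin n → ℝ) → ℝ) → ((Fin n → ℝ) → ℝ)
  | [], g => g
  | s :: rest, g => dirDeriv s (listDeriv rest g)

/-- The list of coordinate directions encoded by a multi-index `α`. -/
def mIndexList {n : ℕ} (α : Fin n → ℕ) : List (Fin n) :=
  (List.finRange n).flatMap fun s => List.replicate (α s) s

/-- Multi-index partial derivative `∂^α g (0)` at the origin. -/
def mderiv {n : ℕ} (g : (Fin n → ℝ) → ℝ) (α : Fin n → ℕ) : ℝ :=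
  listDeriv (mIndexList α) g 0

/-- `f` has graded order at most `l` (w.r.t. the weights `w`):
`∂^α f^{(j)}(0) = 0` whenever `w_j − Σ_s α_s w_s > l`. -/
def GradedOrderLE {n : ℕ} (w : Fin n → ℕ) (f : VF n) (l : ℤ) : Prop :=
  ∀ (j : Fin n) (α : Fin n → ℕ),
    l < (w j : ℤ) - ∑ s, (α s : ℤ) * (w s : ℤ) →
    mderiv (fun x => f x j) α = 0

/-- The weighted Taylor part of weight `l` of a vector field `f`: its `j`-th
component is `Σ_{α : Σ_s α_s w_s = w_j − l} (∂^α f^{(j)}(0)/α!) x^α`. -/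
def taylorPart {n : ℕ} (w : Fin n → ℕ) (f : VF n) (l : ℕ) : VF n :=
  fun x j =>
    ∑ β : Fin n → Fin (w j + 1),
      if (∑ s, (β s : ℤ) * (w s : ℤ)) = (w j : ℤ) - (l : ℤ) then
        (mderiv (fun y => f y j) (fun s => (β s : ℕ)) /
            ((∏ s, Nat.factorial (β s) : ℕ) : ℝ)) *
          ∏ s, x s ^ (β s : ℕ)
      else 0

/-- The nilpotent approximation: weighted Taylor part of weight `2` of the
drift `f₀` and of weight `1` of the fields `f₁,…,f_k`. -/
def nilApprox {n k : ℕ} (w : Fin n → ℕ) (f : Fin (k + 1) → VF n) :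
    Fin (k + 1) → VF n :=
  fun i => if i = 0 then taylorPart w (f i) 2 else taylorPart w (f i) 1

section ListDeriv

variable {n : ℕ}

lemma ContDiff.dirDeriv {g : (Fin n → ℝ) → ℝ} (hg : ContDiff ℝ (⊤ : ℕ∞) g) (s : Fin n) :
    ContDiff ℝ (⊤ : ℕ∞) (dirDeriv s g) :=
  (hg.fderiv_right (m := (⊤ : ℕ∞)) (by simp)).clm_apply contDiff_const

lemma ContDiff.listDeriv {g : (Fin n → ℝ) → ℝ} (hg : ContDiff ℝ (⊤ : ℕ∞) g) (L : List (Fin n)) :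
    ContDiff ℝ (⊤ : ℕ∞) (listDeriv L g) := by
  induction L with
  | nil => exact hg
  | cons s L ih => exact ih.dirDeriv s

lemma ContDiff.differentiable_top {E F : Type*} [NormedAddCommGroup E] [NormedSpace ℝ E]
    [NormedAddCommGroup F] [NormedSpace ℝ F] {g : E → F} (hg : ContDiff ℝ (⊤ : ℕ∞) g) :
    Differentiable ℝ g :=
  hg.differentiable (by simp)

lemma listDeriv_append (L M : List (Fin n)) (g : (Fin n → ℝ) → ℝ) :
    listDeriv (L ++ M) g = listDeriv L (listDeriv M g) := by
  induction L with
  | nil => rfl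
  | cons s L ih => simp [listDeriv, ih]

lemma dirDeriv_add {g h : (Fin n → ℝ) → ℝ} (hg : Differentiable ℝ g) (hh : Differentiable ℝ h)
    (s : Fin n) : dirDeriv s (g + h) = dirDeriv s g + dirDeriv s h := by
  ext x
  simp [dirDeriv, fderiv_add (hg x) (hh x)]

lemma dirDeriv_sub {g h : (Fin n → ℝ) → ℝ} (hg : Differentiable ℝ g) (hh : Differentiable ℝ h)
    (s : Fin n) : dirDeriv s (g - h) = dirDeriv s g - dirDeriv s h := by
  ext x
  simp [dirDeriv, fderiv_sub (hg x) (hh x)]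

lemma dirDeriv_mul {g h : (Fin n → ℝ) → ℝ} (hg : Differentiable ℝ g) (hh : Differentiable ℝ h)
    (s : Fin n) : dirDeriv s (g * h) = dirDeriv s g * h + g * dirDeriv s h := by
  ext x
  simp [dirDeriv, fderiv_mul (hg x) (hh x)]
  ring

lemma listDeriv_add {g h : (Fin n → ℝ) → ℝ} (hg : ContDiff ℝ (⊤ : ℕ∞) g)
    (hh : ContDiff ℝ (⊤ : ℕ∞) h) (L : List (Fin n)) :
    listDeriv L (g + h) = listDeriv L g + listDeriv L h := by
  induction L with
  | nil => rfl
  | cons s L ih =>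
    simp only [listDeriv, ih]
    exact dirDeriv_add (hg.listDeriv L).differentiable_top (hh.listDeriv L).differentiable_top s

lemma listDeriv_sub {g h : (Fin n → ℝ) → ℝ} (hg : ContDiff ℝ (⊤ : ℕ∞) g)
    (hh : ContDiff ℝ (⊤ : ℕ∞) h) (L : List (Fin n)) :
    listDeriv L (g - h) = listDeriv L g - listDeriv L h := by
  induction L with
  | nil => rfl
  | cons s L ih =>
    simp only [listDeriv, ih]
    exact dirDeriv_sub (hg.listDeriv L).differentiable_top (hh.listDeriv L).differentiable_top s

lemma dirDeriv_comm {g : (Fin n → ℝ) → ℝ} (hg : ContDiff ℝ (⊤ : ℕ∞) g) (s t : Fin n) :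
    dirDeriv s (dirDeriv t g) = dirDeriv t (dirDeriv s g) := by
  have hd : Differentiable ℝ (fderiv ℝ g) :=
    (hg.fderiv_right (m := (⊤ : ℕ∞)) (by simp)).differentiable_top
  have key (a b : Fin n) (x : Fin n → ℝ) : dirDeriv a (dirDeriv b g) x
      = fderiv ℝ (fderiv ℝ g) x (Pi.single a 1) (Pi.single b 1) := by
    simp only [dirDeriv]
    change fderiv ℝ (fun y => fderiv ℝ g y (Pi.single b 1)) x _ = _
    rw [fderiv_clm_apply (hd x) (differentiableAt_const _)]
    simp
  ext x
  rw [key, key]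
  refine (hg.contDiffAt.isSymmSndFDerivAt ?_).eq _ _
  simp only [minSmoothness_of_isRCLikeNormedField]
  exact WithTop.coe_le_coe.2 le_top

lemma listDeriv_perm {g : (Fin n → ℝ) → ℝ} (hg : ContDiff ℝ (⊤ : ℕ∞) g) {L M : List (Fin n)}
    (h : L.Perm M) : listDeriv L g = listDeriv M g := by
  induction h with
  | nil => rfl
  | cons s _ ih => simp [listDeriv, ih]
  | swap s t L => exact dirDeriv_comm (hg.listDeriv L) t s
  | trans _ _ h₁ h₂ => exact h₁.trans h₂

lemma count_mIndexList (α : Fin n → ℕ) (s : Fin n) : (mIndexList α).count s = α s := by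
  simp only [mIndexList, List.count_flatMap, Function.comp_def, List.count_replicate, beq_iff_eq]
  rw [← List.ofFn_eq_map, List.sum_ofFn]
  simp

lemma mIndexList_count_perm (L : List (Fin n)) : (mIndexList fun s => L.count s).Perm L :=
  List.perm_iff_count.2 fun s => count_mIndexList _ s

lemma sum_map_eq_sum_count_mul (w : Fin n → ℤ) (L : List (Fin n)) :
    (L.map w).sum = ∑ s, (L.count s : ℤ) * w s := by
  rw [Finset.sum_list_map_count, ← Finset.sum_subset (Finset.subset_univ L.toFinset)]
  · simp
  · intro s _ hs
    simp [List.count_eq_zero.2 (by simpa using hs)]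

lemma contDiff_mvPolynomial_eval (p : MvPolynomial (Fin n) ℝ) :
    ContDiff ℝ (⊤ : ℕ∞) fun x : Fin n → ℝ => MvPolynomial.eval x p := by
  induction p using MvPolynomial.induction_on with
  | C a => simpa using contDiff_const
  | add p q hp hq => simpa using hp.add hq
  | mul_X p i hp => simpa using hp.mul (contDiff_apply ℝ ℝ i)

lemma dirDeriv_mvPolynomial_eval (p : MvPolynomial (Fin n) ℝ) (s : Fin n) :
    dirDeriv s (fun x => MvPolynomial.eval x p) =
      fun x => MvPolynomial.eval x (MvPolynomial.pderiv s p) := by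
  have hd (q : MvPolynomial (Fin n) ℝ) := (contDiff_mvPolynomial_eval q).differentiable_top
  induction p using MvPolynomial.induction_on with
  | C a => ext x; simp [dirDeriv]
  | add p q hp hq =>
    have := dirDeriv_add (hd p) (hd q) s
    rw [hp, hq] at this
    simpa [Pi.add_def] using this
  | mul_X p i hp =>
    have := dirDeriv_mul (hd p) (hd (MvPolynomial.X i)) s
    rw [hp] at this
    have hX : dirDeriv s (fun x : Fin n → ℝ => MvPolynomial.eval x (MvPolynomial.X i)) =
        fun x => MvPolynomial.eval x (MvPolynomial.pderiv s (MvPolynomial.X i)) := by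
      ext x
      simp only [dirDeriv, MvPolynomial.eval_X, (hasFDerivAt_apply (𝕜 := ℝ) i x).fderiv,
        MvPolynomial.pderiv_X]
      by_cases h : i = s
      · subst h; simp
      · simp [h]
    rw [hX] at this
    simp only [Pi.add_def, Pi.mul_def, ← map_mul, ← map_add] at this
    rw [this]
    ext x
    rw [Derivation.leibniz]
    simp only [smul_eq_mul, map_add, map_mul]
    ring

lemma listDeriv_mvPolynomial_eval_zero (p : MvPolynomial (Fin n) ℝ) (L : List (Fin n)) :
    listDeriv L (fun x => MvPolynomial.eval x p) 0 =
      p.coeff (Finsupp.equivFunOnFinite.symm fun s => L.count s) *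
        ((∏ s, (L.count s).factorial : ℕ) : ℝ) := by
  induction L using List.reverseRecOn generalizing p with
  | nil =>
    have h0 : (Finsupp.equivFunOnFinite.symm fun _ : Fin n => 0) = 0 := by ext; simp
    simp [listDeriv, h0, ← MvPolynomial.constantCoeff_eq]
  | append_singleton L t ih =>
    have hc : (Finsupp.equivFunOnFinite.symm fun s => (L ++ [t]).count s) =
        (Finsupp.equivFunOnFinite.symm fun s => L.count s) + Finsupp.single t 1 := by
      ext s
      simp [List.count_append, List.count_singleton, Finsupp.single_apply]
    have hf : ∏ s, ((L ++ [t]).count s).factorial =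
        (L.count t + 1) * ∏ s, (L.count s).factorial := by
      rw [← Finset.mul_prod_erase _ _ (Finset.mem_univ t),
        ← Finset.mul_prod_erase _ (fun s => (L.count s).factorial) (Finset.mem_univ t), ← mul_assoc]
      congr 1
      · simp [List.count_append, Nat.factorial_succ]
      · refine Finset.prod_congr rfl fun s hs => ?_
        simp [List.count_append, (Finset.ne_of_mem_erase hs).symm]
    rw [listDeriv_append, hc, hf]
    simp only [listDeriv, dirDeriv_mvPolynomial_eval, ih, MvPolynomial.coeff_pderiv]
    simp only [Finsupp.equivFunOnFinite_symm_apply_apply, Nat.cast_mul, Nat.cast_add, Nat.cast_one]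
    ring

end ListDeriv

section DerivSupported

variable {n : ℕ} {w : Fin n → ℕ}

/-- The iterated partial derivatives of `g` at the origin vanish unless their weighted degree
lies in `S`. -/
def DerivSupported (w : Fin n → ℕ) (g : (Fin n → ℝ) → ℝ) (S : Set ℤ) : Prop :=
  ∀ L : List (Fin n), (L.map fun s => (w s : ℤ)).sum ∉ S → listDeriv L g 0 = 0

/-- The weighted Taylor expansion of the smooth vector field `V` at the origin, in which
`x^α ∂_j` has degree `∑ s, α s * w s - w j`, has terms with degrees in `S` only. -/
structure VFSupported (w : Fin n → ℕ) (V : VF n) (S : Set ℤ) : Prop where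
  contDiff : ContDiff ℝ (⊤ : ℕ∞) V
  derivSupported (j : Fin n) : DerivSupported w (fun x => V x j) {p | p - w j ∈ S}

namespace DerivSupported

variable {g h : (Fin n → ℝ) → ℝ} {S T U : Set ℤ}

lemma add (hg : ContDiff ℝ (⊤ : ℕ∞) g) (hh : ContDiff ℝ (⊤ : ℕ∞) h)
    (hS : DerivSupported w g S) (hT : DerivSupported w h S) : DerivSupported w (g + h) S :=
  fun L hL => by simp [listDeriv_add hg hh, hS L hL, hT L hL]

lemma sub (hg : ContDiff ℝ (⊤ : ℕ∞) g) (hh : ContDiff ℝ (⊤ : ℕ∞) h)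
    (hS : DerivSupported w g S) (hT : DerivSupported w h S) : DerivSupported w (g - h) S :=
  fun L hL => by simp [listDeriv_sub hg hh, hS L hL, hT L hL]

lemma zero : DerivSupported w 0 S := by
  intro L _
  have : listDeriv L (0 : (Fin n → ℝ) → ℝ) = 0 := by
    simpa using listDeriv_sub (g := (0 : (Fin n → ℝ) → ℝ)) (h := 0) contDiff_const
      contDiff_const L
  simp [this]

lemma sum {ι : Type*} (I : Finset ι) {g : ι → (Fin n → ℝ) → ℝ}
    (hg : ∀ i, ContDiff ℝ (⊤ : ℕ∞) (g i)) (hS : ∀ i, DerivSupported w (g i) S) :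
    DerivSupported w (∑ i ∈ I, g i) S := by
  classical
  induction I using Finset.induction_on with
  | empty => exact zero
  | insert i I hi ih =>
    rw [Finset.sum_insert hi]
    refine (hS i).add (hg i) ?_ ih
    rw [Finset.sum_fn]
    exact ContDiff.sum fun i _ => hg i

lemma dirDeriv (hS : DerivSupported w g S) (s : Fin n) :
    DerivSupported w (dirDeriv s g) {p | p + w s ∈ S} := by
  intro L hL
  have := hS (L ++ [s]) (by simpa using hL)
  rwa [listDeriv_append] at this

lemma mul (hg : ContDiff ℝ (⊤ : ℕ∞) g) (hh : ContDiff ℝ (⊤ : ℕ∞) h)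
    (hS : DerivSupported w g S) (hT : DerivSupported w h T)
    (hU : ∀ p ∈ S, ∀ q ∈ T, p + q ∈ U) : DerivSupported w (g * h) U := by
  intro L hL
  induction L using List.reverseRecOn generalizing g h S T U with
  | nil =>
    by_cases h0 : (0 : ℤ) ∈ S
    · have : (0 : ℤ) ∉ T := fun h1 => hL (by simpa using hU 0 h0 0 h1)
      have := hT [] (by simpa using this)
      simp_all [listDeriv]
    · have := hS [] (by simpa using h0)
      simp_all [listDeriv]
  | append_singleton L s ih =>
    have hL' : (L.map fun s => (w s : ℤ)).sum ∉ {p | p + (w s : ℤ) ∈ U} := by simpa using hL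
    rw [listDeriv_append]
    simp only [listDeriv]
    have c₁ : ContDiff ℝ (⊤ : ℕ∞) (_root_.dirDeriv s g * h) := (hg.dirDeriv s).mul hh
    have c₂ : ContDiff ℝ (⊤ : ℕ∞) (g * _root_.dirDeriv s h) := hg.mul (hh.dirDeriv s)
    rw [dirDeriv_mul hg.differentiable_top hh.differentiable_top, listDeriv_add c₁ c₂, Pi.add_apply,
      ih (hg.dirDeriv s) hh (hS.dirDeriv s) hT ?_ hL',
      ih hg (hh.dirDeriv s) hS (hT.dirDeriv s) ?_ hL', add_zero]
    · intro p hp q hq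
      simpa [add_assoc] using hU p hp _ hq
    · intro p hp q hq
      simpa [add_right_comm] using hU _ hp q hq

end DerivSupported

lemma fderiv_apply_eq_sum_dirDeriv {V : VF n} (hV : Differentiable ℝ V) (x v : Fin n → ℝ)
    (j : Fin n) : fderiv ℝ V x v j = ∑ s, v s * dirDeriv s (fun y => V y j) x := by
  simp only [dirDeriv, fderiv_apply (hV x) j]
  conv_lhs => rw [pi_eq_sum_univ' v]
  simp

lemma ContDiff.lieB {V W : VF n} (hV : ContDiff ℝ (⊤ : ℕ∞) V) (hW : ContDiff ℝ (⊤ : ℕ∞) W) :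
    ContDiff ℝ (⊤ : ℕ∞) (lieB V W) :=
  ((hW.fderiv_right (m := (⊤ : ℕ∞)) (by simp)).clm_apply hV).sub
    ((hV.fderiv_right (m := (⊤ : ℕ∞)) (by simp)).clm_apply hW)

lemma lieB_sub_lieB {V V' W W' : VF n} (hV : Differentiable ℝ V) (hV' : Differentiable ℝ V')
    (hW : Differentiable ℝ W) (hW' : Differentiable ℝ W') :
    lieB V W - lieB V' W' = lieB (V - V') W + lieB V' (W - W') := by
  ext x : 1
  simp only [lieB, Pi.sub_apply, Pi.add_apply, fderiv_sub (hV x) (hV' x),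
    fderiv_sub (hW x) (hW' x), map_sub, sub_apply]
  abel

namespace VFSupported

variable {V W : VF n} {S T U : Set ℤ}

lemma add (hV : VFSupported w V S) (hW : VFSupported w W S) : VFSupported w (V + W) S where
  contDiff := hV.contDiff.add hW.contDiff
  derivSupported j := (hV.derivSupported j).add (contDiff_pi.1 hV.contDiff j)
    (contDiff_pi.1 hW.contDiff j) (hW.derivSupported j)

lemma mono (hV : VFSupported w V S) (h : S ⊆ T) : VFSupported w V T where
  contDiff := hV.contDiff
  derivSupported j L hL := hV.derivSupported j L fun hL' => hL (h hL')

lemma lieB (hV : VFSupported w V S) (hW : VFSupported w W T)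
    (hU : ∀ p ∈ S, ∀ q ∈ T, p + q ∈ U) : VFSupported w (lieB V W) U where
  contDiff := hV.contDiff.lieB hW.contDiff
  derivSupported j := by
    have cV := contDiff_pi.1 hV.contDiff
    have cW := contDiff_pi.1 hW.contDiff
    have key : (fun x => _root_.lieB V W x j) =
        ∑ s, (fun x => V x s) * dirDeriv s (fun x => W x j) -
          ∑ s, (fun x => W x s) * dirDeriv s (fun x => V x j) := by
      ext x
      simp [_root_.lieB, fderiv_apply_eq_sum_dirDeriv hV.contDiff.differentiable_top,
        fderiv_apply_eq_sum_dirDeriv hW.contDiff.differentiable_top]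
    have c₁ s := (cV s).mul ((cW j).dirDeriv s)
    have c₂ s := (cW s).mul ((cV j).dirDeriv s)
    rw [key]
    refine DerivSupported.sub ?_ ?_ (.sum _ c₁ fun s => ?_) (.sum _ c₂ fun s => ?_)
    · rw [Finset.sum_fn]
      exact ContDiff.sum fun s _ => c₁ s
    · rw [Finset.sum_fn]
      exact ContDiff.sum fun s _ => c₂ s
    · refine (hV.derivSupported s).mul (cV s) ((cW j).dirDeriv s)
        ((hW.derivSupported j).dirDeriv s) fun p hp q hq => ?_
      have := hU _ hp _ hq
      simp only [Set.mem_ofPred_eq]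
      convert this using 1
      ring
    · refine (hW.derivSupported s).mul (cW s) ((cV j).dirDeriv s)
        ((hV.derivSupported j).dirDeriv s) fun p hp q hq => ?_
      have := hU _ hq _ hp
      simp only [Set.mem_ofPred_eq]
      convert this using 1
      ring

lemma apply_zero_eq_zero (hV : VFSupported w V S) {j : Fin n} (h : -(w j : ℤ) ∉ S) :
    V 0 j = 0 :=
  hV.derivSupported j [] (by simpa using h)

end VFSupported

end DerivSupported

section TaylorPart

variable {n : ℕ} {w : Fin n → ℕ}

/-- The polynomial whose evaluation is the `j`-th component of `taylorPart w f l`. -/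
def taylorPartPoly (w : Fin n → ℕ) (f : VF n) (l : ℕ) (j : Fin n) : MvPolynomial (Fin n) ℝ :=
  ∑ β : Fin n → Fin (w j + 1),
    if (∑ s, (β s : ℤ) * (w s : ℤ)) = (w j : ℤ) - (l : ℤ) then
      MvPolynomial.monomial (Finsupp.equivFunOnFinite.symm fun s => (β s : ℕ))
        (mderiv (fun y => f y j) (fun s => (β s : ℕ)) /
          ((∏ s, Nat.factorial (β s) : ℕ) : ℝ))
    else 0

lemma taylorPart_apply (f : VF n) (l : ℕ) (x : Fin n → ℝ) (j : Fin n) :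
    taylorPart w f l x j = MvPolynomial.eval x (taylorPartPoly w f l j) := by
  simp only [taylorPart, taylorPartPoly, map_sum]
  refine Finset.sum_congr rfl fun β _ => ?_
  split_ifs
  · rw [MvPolynomial.eval_monomial, Finsupp.prod_fintype _ _ (by simp)]
    simp
  · simp

lemma coeff_taylorPartPoly (hw : ∀ j, 0 < w j) (f : VF n) (l : ℕ) (j : Fin n) (α : Fin n → ℕ) :
    (taylorPartPoly w f l j).coeff (Finsupp.equivFunOnFinite.symm α) =
      if (∑ s, (α s : ℤ) * (w s : ℤ)) = (w j : ℤ) - (l : ℤ) then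
        mderiv (fun y => f y j) α / ((∏ s, Nat.factorial (α s) : ℕ) : ℝ)
      else 0 := by
  simp only [taylorPartPoly, MvPolynomial.coeff_sum, apply_ite (MvPolynomial.coeff _),
    MvPolynomial.coeff_monomial, MvPolynomial.coeff_zero, EmbeddingLike.apply_eq_iff_eq]
  split_ifs with h
  · have hle (s : Fin n) : α s < w j + 1 := by
      have h₁ : (α s : ℤ) * w s ≤ ∑ s, (α s : ℤ) * (w s : ℤ) :=
        Finset.single_le_sum (f := fun s => (α s : ℤ) * (w s : ℤ)) (fun _ _ => by positivity)
          (Finset.mem_univ s)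
      have h₂ : (1 : ℤ) ≤ w s := by exact_mod_cast hw s
      have h₃ : (α s : ℤ) ≤ α s * w s := le_mul_of_one_le_right (by positivity) h₂
      omega
    rw [Finset.sum_eq_single (fun s => ⟨α s, hle s⟩)]
    · simp [h]
    · intro β _ hβ
      have : (fun s => (β s : ℕ)) ≠ α := by
        rintro rfl
        exact hβ rfl
      simp [this]
    · simp
  · refine Finset.sum_eq_zero fun β _ => ?_
    split_ifs with h₁ h₂
    · subst h₂
      exact absurd h₁ h
    · rfl
    · rfl

lemma listDeriv_taylorPart_zero (hw : ∀ j, 0 < w j) {f : VF n} (hf : ContDiff ℝ (⊤ : ℕ∞) f)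
    (l : ℕ) (j : Fin n) (L : List (Fin n)) :
    listDeriv L (fun x => taylorPart w f l x j) 0 =
      if (L.map fun s => (w s : ℤ)).sum = (w j : ℤ) - l then
        listDeriv L (fun x => f x j) 0 else 0 := by
  have hne : ((∏ s, (L.count s).factorial : ℕ) : ℝ) ≠ 0 := by
    exact_mod_cast Finset.prod_ne_zero_iff.2 fun s _ => Nat.factorial_ne_zero _
  simp only [taylorPart_apply]
  rw [listDeriv_mvPolynomial_eval_zero, coeff_taylorPartPoly hw, sum_map_eq_sum_count_mul, mderiv,
    listDeriv_perm (contDiff_pi.1 hf j) (mIndexList_count_perm L)]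
  split_ifs
  · exact div_mul_cancel₀ _ hne
  · simp

lemma contDiff_taylorPart (f : VF n) (l : ℕ) : ContDiff ℝ (⊤ : ℕ∞) (taylorPart w f l) :=
  contDiff_pi.2 fun j => by
    simpa only [taylorPart_apply] using contDiff_mvPolynomial_eval (taylorPartPoly w f l j)

lemma vfSupported_taylorPart (hw : ∀ j, 0 < w j) {f : VF n} (hf : ContDiff ℝ (⊤ : ℕ∞) f)
    (l : ℕ) : VFSupported w (taylorPart w f l) {-(l : ℤ)} where
  contDiff := contDiff_taylorPart f l
  derivSupported j L hL := by
    rw [listDeriv_taylorPart_zero hw hf, if_neg]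
    intro h
    apply hL
    simp [h]

lemma vfSupported_sub_taylorPart (hw : ∀ j, 0 < w j) {f : VF n} (hf : ContDiff ℝ (⊤ : ℕ∞) f)
    {l : ℕ} (hl : GradedOrderLE w f l) :
    VFSupported w (f - taylorPart w f l) (Set.Ioi (-(l : ℤ))) where
  contDiff := hf.sub (contDiff_taylorPart f l)
  derivSupported j L hL := by
    have hsub : (fun x => (f - taylorPart w f l) x j) =
        (fun x => f x j) - fun x => taylorPart w f l x j := rfl
    rw [hsub, listDeriv_sub (contDiff_pi.1 hf j) (contDiff_pi.1 (contDiff_taylorPart f l) j),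
      Pi.sub_apply, listDeriv_taylorPart_zero hw hf]
    split_ifs with h
    · exact sub_self _
    · have := hl j (fun s => L.count s) (by
        rw [← sum_map_eq_sum_count_mul (fun s => (w s : ℤ))]
        simp only [Set.mem_ofPred_eq, Set.mem_Ioi, not_lt] at hL
        omega)
      rw [mderiv, listDeriv_perm (contDiff_pi.1 hf j) (mIndexList_count_perm L)] at this
      simp [this]

end TaylorPart

section NilApprox

variable {n k : ℕ} {w : Fin n → ℕ}

lemma wt_of (i : Fin (k + 1)) : wt (FreeMagma.of i) = if i = 0 then 2 else 1 := by
  induction i using Fin.cases with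
  | zero => simp [wt, occ, (Fin.succ_ne_zero _).symm]
  | succ i => simp [wt, occ]

lemma wt_mul (a b : FreeMagma (Fin (k + 1))) : wt (a.mul b) = wt a + wt b := by
  simp only [wt, occ, Finset.sum_add_distrib]
  ring

lemma wt_pos (Λ : FreeMagma (Fin (k + 1))) : 0 < wt Λ := by
  induction Λ using FreeMagma.rec with
  | of i => rw [wt_of]; split_ifs <;> norm_num
  | mul a b ha hb => rw [wt_mul]; omega

lemma nilApprox_apply (f : Fin (k + 1) → VF n) (i : Fin (k + 1)) :
    nilApprox w f i = taylorPart w (f i) (wt (FreeMagma.of i)) := by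
  rw [nilApprox, wt_of]
  split_ifs <;> rfl

/-- Brackets of the nilpotent approximation are homogeneous, and they are the leading parts of
the corresponding brackets of the original vector fields. -/
lemma vfSupported_subst_nilApprox (hw : ∀ j, 0 < w j) {f : Fin (k + 1) → VF n}
    (hf : ∀ i, ContDiff ℝ (⊤ : ℕ∞) (f i))
    (horder : ∀ i, GradedOrderLE w (f i) (wt (FreeMagma.of i) : ℤ))
    (Λ : FreeMagma (Fin (k + 1))) :
    VFSupported w (subst (nilApprox w f) Λ) {-(wt Λ : ℤ)} ∧
      VFSupported w (subst f Λ - subst (nilApprox w f) Λ) (Set.Ioi (-(wt Λ : ℤ))) := by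
  induction Λ using FreeMagma.rec with
  | of i =>
    simp only [subst, nilApprox_apply]
    exact ⟨vfSupported_taylorPart hw (hf i) _, vfSupported_sub_taylorPart hw (hf i) (horder i)⟩
  | mul a b ha hb =>
    obtain ⟨ha, ha'⟩ := ha
    obtain ⟨hb, hb'⟩ := hb
    have hfa : ContDiff ℝ (⊤ : ℕ∞) (subst f a) := by simpa using ha'.contDiff.add ha.contDiff
    have hfb : VFSupported w (subst f b) (Set.Ici (-(wt b : ℤ))) := by
      simpa using (hb'.mono Set.Ioi_subset_Ici_self).add (hb.mono (T := Set.Ici _) (by simp))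
    simp only [subst, wt_mul]
    refine ⟨ha.lieB hb ?_, ?_⟩
    · simp only [Set.mem_singleton_iff]
      rintro p rfl q rfl
      push_cast
      ring
    · rw [lieB_sub_lieB hfa.differentiable_top ha.contDiff.differentiable_top
        hfb.contDiff.differentiable_top hb.contDiff.differentiable_top]
      refine (ha'.lieB hfb fun p hp q hq => ?_).add (ha.lieB hb' fun p hp q hq => ?_) <;>
      · simp only [Set.mem_Ioi, Set.mem_Ici, Set.mem_singleton_iff] at *
        push_cast
        omega

end NilApprox

lemma mem_span_single_iff {n : ℕ} (P : Fin n → Prop) (v : Fin n → ℝ) :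
    v ∈ Submodule.span ℝ ((fun h : Fin n => (Pi.single h 1 : Fin n → ℝ)) '' {h | P h}) ↔
      ∀ j, ¬ P j → v j = 0 := by
  constructor
  · intro hv j hj
    induction hv using Submodule.span_induction with
    | mem x hx =>
      obtain ⟨h, hh, rfl⟩ := hx
      have : j ≠ h := by rintro rfl; exact hj hh
      simp [this]
    | zero => rfl
    | add x y _ _ hx hy => simp [hx, hy]
    | smul c x _ hx => simp [hx]
  · intro hv
    rw [pi_eq_sum_univ' v]
    refine Submodule.sum_mem _ fun j _ => ?_
    by_cases hj : P j
    · exact Submodule.smul_mem _ _ (Submodule.subset_span ⟨j, hj, rfl⟩)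
    · simp [hv j hj]

/-- the Lie algebras generated at `0` by the original fields and
by their nilpotent approximation coincide. -/
theorem lie_algebra_of_nilpotent_approximation
    {n k : ℕ}
    (f : Fin (k + 1) → VF n)
    (hsmooth : ∀ i, ContDiff ℝ (⊤ : ℕ∞) (f i))
    (hdrift : f 0 (0 : Fin n → ℝ) = 0)
    (w : Fin n → ℕ) (hw : ∀ j, 0 < w j)
    (d : ℕ → ℕ) (hd : ∀ i, d i = Module.finrank ℝ (LxSub f i))
    (hwdef : ∀ i : ℕ, 1 ≤ i → ∀ j : Fin n,
      d (i - 1) < (j : ℕ) + 1 → (j : ℕ) + 1 ≤ d i → w j = i)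
    (hadapted : ∀ i : ℕ, LxSub f i =
      Submodule.span ℝ
        ((fun h : Fin n => (Pi.single h 1 : Fin n → ℝ)) '' {h | (h : ℕ) < d i}))
    (horder : ∀ Λ : FreeMagma (Fin (k + 1)),
      GradedOrderLE w (subst f Λ) (wt Λ : ℤ))
    (m : ℕ)
    (hm : LxSub f m =
      Submodule.span ℝ { v | ∃ Λ : FreeMagma (Fin (k + 1)), v = subst f Λ 0 })
    (fh : Fin (k + 1) → VF n) (hfh : fh = nilApprox w f) :
    Submodule.span ℝ { v | ∃ Λ : FreeMagma (Fin (k + 1)), v = subst f Λ 0 } =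
      Submodule.span ℝ { v | ∃ Λ : FreeMagma (Fin (k + 1)), v = subst fh Λ 0 } := by
  subst hfh
  have hsub (Λ : FreeMagma (Fin (k + 1))) :
      subst f Λ 0 - subst (nilApprox w f) Λ 0 ∈ LxSub f (wt Λ - 1) := by
    obtain ⟨hhom, hlow⟩ := vfSupported_subst_nilApprox hw hsmooth (fun i => horder (.of i)) Λ
    have hmem : subst f Λ 0 ∈ LxSub f (wt Λ) := Submodule.subset_span ⟨Λ, le_rfl, rfl⟩
    rw [hadapted, mem_span_single_iff] at hmem
    rw [hadapted, mem_span_single_iff]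
    intro j hj
    by_cases hwj : wt Λ ≤ w j
    · exact hlow.apply_zero_eq_zero (j := j) (by simpa using hwj)
    · have hge : ¬ (j : ℕ) < d (wt Λ) := fun hlt =>
        hwj (hwdef (wt Λ) (wt_pos Λ) j (by omega) hlt).ge
      rw [Pi.sub_apply, hmem j hge, hhom.apply_zero_eq_zero (by simp; omega), sub_zero]
  have hLx (i : ℕ) : LxSub f i ≤
      Submodule.span ℝ { v | ∃ Λ : FreeMagma (Fin (k + 1)), v = subst f Λ 0 } :=
    Submodule.span_mono fun v ⟨Λ, _, hv⟩ => ⟨Λ, hv⟩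
  have hLxh (i : ℕ) : LxSub f i ≤ Submodule.span ℝ
      { v | ∃ Λ : FreeMagma (Fin (k + 1)), v = subst (nilApprox w f) Λ 0 } := by
    induction i using Nat.strong_induction_on with
    | _ i ih =>
      refine Submodule.span_le.2 ?_
      rintro _ ⟨Λ, hΛ, rfl⟩
      have hpos := wt_pos Λ
      have := Submodule.add_mem _ (ih (wt Λ - 1) (by omega) (hsub Λ))
        (Submodule.subset_span ⟨Λ, rfl⟩)
      simpa using this
  refine le_antisymm (hm ▸ hLxh m) (Submodule.span_le.2 ?_)
  rintro _ ⟨Λ, rfl⟩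
  have hΛ : subst f Λ 0 ∈
      Submodule.span ℝ { v | ∃ Λ : FreeMagma (Fin (k + 1)), v = subst f Λ 0 } :=
    Submodule.subset_span ⟨Λ, rfl⟩
  simpa using Submodule.sub_mem _ hΛ (hLx _ (hsub Λ))
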